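/- On a weighted rooted tree T with leaves X and tree path metric d_T, for any two equal-mass discrete measures μ, ν on X, the optimal transport distance under d_T equals Σ_{v ∈ T, v ≠ root} w(e_v)·|μ(L_v) − ν(L_v)|, where L_v is the set of leaves in the subtree rooted at v and w(e_v) is the weight of the edge from v to its parent. In particular, optimal transport on a tree metric is an L₁ distance between the vectors (w(e_v)·μ(L_v))_v and (w(e_v)·ν(L_v))_v. -/

import Mathlib

noncomputable section
open Finset Classical

variable {V : Type*} [Fintype V] [DecidableEq V]

/-- Total mass of a discrete measure `μ` in the subtree rooted at `v` (the set of
vertices having `v` as an iterated-parent ancestor, including `v` itself). -/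

def subMass (parent : V → V) (μ : V → ℝ) (v : V) : ℝ :=
  ∑ x, if ∃ k, parent^[k] x = v then μ x else 0

/-- The weighted path metric of a rooted tree, where `w v` is the weight of the edge
from `v` to its parent: the edge above `v` lies on the path from `x` to `y` iff exactly
one of `x, y` belongs to the subtree of `v`. -/

def treeDist (root : V) (parent : V → V) (w : V → ℝ) (x y : V) : ℝ :=
  ∑ v ∈ Finset.univ.erase root,
    w v * |(if ∃ k, parent^[k] x = v then (1 : ℝ) else 0) -
            (if ∃ k, parent^[k] y = v then (1 : ℝ) else 0)|

/-- A transport plan (coupling) between two discrete measures on `V`. -/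
def IsPlan (μ ν : V → ℝ) (τ : V → V → ℝ) : Prop :=
  (∀ x y, 0 ≤ τ x y) ∧ (∀ x, ∑ y, τ x y = μ x) ∧ (∀ y, ∑ x, τ x y = ν y)

/-- The optimal transport cost between discrete measures `μ`, `ν` on the leaves of the
tree, under the tree path metric. -/
def treeOT (root : V) (parent : V → V) (w : V → ℝ) (μ ν : V → ℝ) : ℝ :=
  sInf {c | ∃ τ : V → V → ℝ, IsPlan μ ν τ ∧
    (∑ x, ∑ y, τ x y * treeDist root parent w x y) = c}

/-- `v` is a leaf: it has no children other than (possibly) itself. -/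
def IsLeaf (parent : V → V) (v : V) : Prop := ∀ u, parent u = v → u = v

/-- Greedy coupling for a laminar family `S`: no set is crossed in both directions. -/
theorem exists_laminar_plan {V : Type*} [Fintype V] (S : V → V → Prop) (r : V)
    (hr : ∀ x, S r x)
    (lam : ∀ u v x, S u x → S v x → (∀ z, S u z → S v z) ∨ (∀ z, S v z → S u z)) :
    ∀ (n : ℕ) (μ ν : V → ℝ), (∀ v, 0 ≤ μ v) → (∀ v, 0 ≤ ν v) → ∑ v, μ v = ∑ v, ν v →
      (univ.filter (fun x => μ x ≠ 0)).card + (univ.filter (fun x => ν x ≠ 0)).card ≤ n →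
      ∃ τ : V → V → ℝ, IsPlan μ ν τ ∧ ∀ v,
        ∑ x, ∑ y, τ x y * |(if S v x then (1 : ℝ) else 0) - (if S v y then (1 : ℝ) else 0)|
          ≤ |∑ x, (if S v x then (1 : ℝ) else 0) * (μ x - ν x)| := by
  intro n
  induction n with
  | zero =>
    intro μ ν hμ hν hm hc
    have h1 : (univ.filter (fun x => μ x ≠ 0)).card = 0 := by omega
    have h2 : (univ.filter (fun x => ν x ≠ 0)).card = 0 := by omega
    simp [Finset.filter_eq_empty_iff] at h1 h2
    refine ⟨fun _ _ => 0, ⟨by simp, by simp [h1], by simp [h2]⟩, by simp [h1, h2]⟩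
  | succ n ih =>
    intro μ ν hμ hν hm hc
    by_cases hz : ∀ x, μ x = 0
    · have h2 : ∀ x, ν x = 0 := by
        have : ∑ v, ν v = 0 := by rw [← hm]; simp [hz]
        rw [Finset.sum_eq_zero_iff_of_nonneg (fun i _ => hν i)] at this
        intro x; exact this x (mem_univ _)
      refine ⟨fun _ _ => 0, ⟨by simp, by simp [hz], by simp [h2]⟩, by simp [hz, h2]⟩
    push Not at hz
    obtain ⟨x0, hx0⟩ := hz
    have hy0 : ∃ y, ν y ≠ 0 := by
      by_contra hcon
      push Not at hcon
      have : ∑ v, μ v = 0 := by rw [hm]; simp [hcon]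
      rw [Finset.sum_eq_zero_iff_of_nonneg (fun i _ => hμ i)] at this
      exact hx0 (this x0 (mem_univ _))
    obtain ⟨y0, hy0⟩ := hy0
    let P : Finset V := univ.filter (fun v => ∃ x y, S v x ∧ S v y ∧ μ x ≠ 0 ∧ ν y ≠ 0)
    have hP : P.Nonempty := ⟨r, by simp only [P, mem_filter, mem_univ, true_and]; exact ⟨x0, y0, hr _, hr _, hx0, hy0⟩⟩
    obtain ⟨v, hvP, hmin⟩ := P.exists_min_image (fun v => (univ.filter (S v)).card) hP
    simp only [P, mem_filter, mem_univ, true_and] at hvP hmin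
    obtain ⟨x, y, hvx, hvy, hx, hy⟩ := hvP
    -- sets strictly below `v` do not meet both supports
    have key : ∀ u z t, S v z → S v t → S u z → ¬ S u t →
        ¬ ∃ x y, S u x ∧ S u y ∧ μ x ≠ 0 ∧ ν y ≠ 0 := by
      intro u z t hz ht huz hut hex
      have hsub : ∀ z, S u z → S v z := by
        rcases lam u v z huz hz with h | h
        · exact h
        · exact absurd (h t ht) hut
      have hlt : (univ.filter (S u)).card < (univ.filter (S v)).card := by
        apply Finset.card_lt_card
        rw [Finset.ssubset_iff_of_subset]
        · exact ⟨t, by simpa using ht, by simpa using hut⟩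
        · intro a ha
          simp only [mem_filter, mem_univ, true_and] at ha ⊢
          exact hsub a ha
      exact absurd (hmin u hex) (not_le.mpr hlt)
    obtain ⟨δ, hδ⟩ : ∃ δ, δ = min (μ x) (ν y) := ⟨_, rfl⟩
    have hδx : δ ≤ μ x := hδ ▸ min_le_left _ _
    have hδy : δ ≤ ν y := hδ ▸ min_le_right _ _
    have hδ0 : 0 ≤ δ := hδ ▸ le_min (hμ x) (hν y)
    let μ' : V → ℝ := fun a => μ a - if a = x then δ else 0
    let ν' : V → ℝ := fun a => ν a - if a = y then δ else 0
    have hμ' : ∀ a, 0 ≤ μ' a := by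
      intro a; simp only [μ']; split_ifs with h
      · subst h; linarith
      · simpa using hμ a
    have hν' : ∀ a, 0 ≤ ν' a := by
      intro a; simp only [ν']; split_ifs with h
      · subst h; linarith
      · simpa using hν a
    have hm' : ∑ a, μ' a = ∑ a, ν' a := by
      simp [μ', ν', Finset.sum_sub_distrib, hm]
    have sμ : univ.filter (fun a => μ' a ≠ 0) ⊆ univ.filter (fun a => μ a ≠ 0) := by
      intro a; simp only [mem_filter, mem_univ, true_and, μ']
      by_cases h : a = x
      · subst h; exact fun _ => hx
      · simp [h]
    have sν : univ.filter (fun a => ν' a ≠ 0) ⊆ univ.filter (fun a => ν a ≠ 0) := by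
      intro a; simp only [mem_filter, mem_univ, true_and, ν']
      by_cases h : a = y
      · subst h; exact fun _ => hy
      · simp [h]
    have hcard : (univ.filter (fun a => μ' a ≠ 0)).card +
        (univ.filter (fun a => ν' a ≠ 0)).card ≤ n := by
      have c1 := Finset.card_le_card sμ
      have c2 := Finset.card_le_card sν
      rcases le_total (μ x) (ν y) with h | h
      · have : (univ.filter (fun a => μ' a ≠ 0)).card < (univ.filter (fun a => μ a ≠ 0)).card := by
          apply Finset.card_lt_card
          rw [Finset.ssubset_iff_of_subset sμ]
          exact ⟨x, by simpa using hx, by simp [μ', hδ, h]⟩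
        omega
      · have : (univ.filter (fun a => ν' a ≠ 0)).card < (univ.filter (fun a => ν a ≠ 0)).card := by
          apply Finset.card_lt_card
          rw [Finset.ssubset_iff_of_subset sν]
          exact ⟨y, by simpa using hy, by simp [ν', hδ, h]⟩
        omega
    obtain ⟨τ, ⟨t0, t1, t2⟩, hτ⟩ := ih μ' ν' hμ' hν' hm' hcard
    refine ⟨fun a b => τ a b + if a = x then (if b = y then δ else 0) else 0,
      ⟨?_, ?_, ?_⟩, ?_⟩
    · intro a b
      have := t0 a b
      dsimp only
      split_ifs <;> linarith
    · intro a
      rw [Finset.sum_add_distrib, t1]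
      by_cases h : a = x <;> simp [h, μ']
    · intro b
      rw [Finset.sum_add_distrib, t2]
      by_cases h : b = y <;> simp [h, ν']
    · intro u
      have e1 : ∑ a, ∑ b, (τ a b + if a = x then (if b = y then δ else 0) else 0) *
          |(if S u a then (1 : ℝ) else 0) - (if S u b then (1 : ℝ) else 0)| =
          ∑ a, ∑ b, τ a b * |(if S u a then (1 : ℝ) else 0) - (if S u b then (1 : ℝ) else 0)| +
          δ * |(if S u x then (1 : ℝ) else 0) - (if S u y then (1 : ℝ) else 0)| := by
        simp only [add_mul, Finset.sum_add_distrib]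
        congr 1
        rw [Finset.sum_eq_single x, Finset.sum_eq_single y]
        · simp
        · intro b _ hb; simp [hb]
        · simp
        · intro a _ ha; simp [ha]
        · simp
      have e2 : ∑ a, (if S u a then (1 : ℝ) else 0) * (μ' a - ν' a) =
          ∑ a, (if S u a then (1 : ℝ) else 0) * (μ a - ν a) -
          δ * ((if S u x then (1 : ℝ) else 0) - (if S u y then (1 : ℝ) else 0)) := by
        have e3 : ∀ a, (if S u a then (1 : ℝ) else 0) * (μ' a - ν' a) =
            (if S u a then (1 : ℝ) else 0) * (μ a - ν a) -
            ((if a = x then (if S u a then (1 : ℝ) else 0) * δ else 0) -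
             (if a = y then (if S u a then (1 : ℝ) else 0) * δ else 0)) := by
          intro a; simp only [μ', ν']; split_ifs <;> ring
        rw [Finset.sum_congr rfl (fun a _ => e3 a), Finset.sum_sub_distrib,
          Finset.sum_sub_distrib, Finset.sum_ite_eq', Finset.sum_ite_eq']
        simp only [mem_univ, if_true]
        ring
      rw [e1]
      have hu := hτ u
      rw [e2] at hu
      by_cases hux : S u x <;> by_cases huy : S u y
      · simp only [hux, huy, if_true] at hu ⊢
        simpa using hu
      · have hno := key u x y hvx hvy hux huy
        have hf : δ ≤ ∑ a, (if S u a then (1 : ℝ) else 0) * (μ a - ν a) := by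
          have hnn : ∀ a ∈ (univ : Finset V),
              0 ≤ (if S u a then (1 : ℝ) else 0) * (μ a - ν a) := by
            intro a _
            split_ifs with h
            · have : ν a = 0 := by
                by_contra hh; exact hno ⟨x, a, hux, h, hx, hh⟩
              rw [this]; simpa using hμ a
            · simp
          have hs := Finset.single_le_sum hnn (mem_univ x)
          have : ν x = 0 := by
            by_contra hh; exact hno ⟨x, x, hux, hux, hx, hh⟩
          simp only [hux, if_true, this] at hs
          linarith
        simp only [hux, huy, if_true, if_false] at hu ⊢
        rw [abs_of_nonneg (by linarith)] at hu
        rw [abs_of_nonneg (hδ0.trans hf)]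
        norm_num at hu ⊢
        linarith
      · have hno := key u y x hvy hvx huy hux
        have hf : ∑ a, (if S u a then (1 : ℝ) else 0) * (μ a - ν a) ≤ -δ := by
          have hnn : ∀ a ∈ (univ : Finset V),
              0 ≤ -((if S u a then (1 : ℝ) else 0) * (μ a - ν a)) := by
            intro a _
            split_ifs with h
            · have : μ a = 0 := by
                by_contra hh; exact hno ⟨a, y, h, huy, hh, hy⟩
              rw [this]; simpa using hν a
            · simp
          have hs := Finset.single_le_sum hnn (mem_univ y)
          have : μ y = 0 := by
            by_contra hh; exact hno ⟨y, y, huy, huy, hh, hy⟩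
          rw [Finset.sum_neg_distrib] at hs
          simp only [huy, if_true, this] at hs
          linarith
        simp only [hux, huy, if_true, if_false] at hu ⊢
        rw [abs_of_nonpos (by linarith)] at hu
        rw [abs_of_nonpos (hf.trans (neg_nonpos.mpr hδ0))]
        norm_num at hu ⊢
        linarith
      · simp only [hux, huy, if_false] at hu ⊢
        simpa using hu

theorem plan_lower {V : Type*} [Fintype V] (S : V → Prop) (μ ν : V → ℝ) (τ : V → V → ℝ)
    (h : IsPlan μ ν τ) :
    |∑ x, (if S x then (1 : ℝ) else 0) * (μ x - ν x)| ≤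
    ∑ x, ∑ y, τ x y * |(if S x then (1 : ℝ) else 0) - (if S y then (1 : ℝ) else 0)| := by
  obtain ⟨t0, t1, t2⟩ := h
  have e : ∑ x, (if S x then (1 : ℝ) else 0) * (μ x - ν x) =
      ∑ x, ∑ y, τ x y * ((if S x then (1 : ℝ) else 0) - (if S y then (1 : ℝ) else 0)) := by
    simp only [mul_sub, Finset.sum_sub_distrib]
    congr 1
    · refine Finset.sum_congr rfl fun x _ => ?_
      rw [← t1 x, Finset.mul_sum]
      exact Finset.sum_congr rfl fun y _ => mul_comm _ _
    · rw [Finset.sum_comm]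
      refine Finset.sum_congr rfl fun x _ => ?_
      rw [← t2 x, Finset.mul_sum]
      exact Finset.sum_congr rfl fun y _ => mul_comm _ _
  rw [e]
  refine (Finset.abs_sum_le_sum_abs _ _).trans (Finset.sum_le_sum fun x _ => ?_)
  refine (Finset.abs_sum_le_sum_abs _ _).trans (Finset.sum_le_sum fun y _ => ?_)
  rw [abs_mul, abs_of_nonneg (t0 x y)]

/-- On a weighted rooted tree, the optimal transport distance between two equal-mass
discrete measures supported on leaves, under the tree path metric, equals
`Σ_{v ≠ root} w(e_v)·|μ(L_v) - ν(L_v)|`; in particular it is the `L₁` distance between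
the vectors `(w(e_v)·μ(L_v))_v` and `(w(e_v)·ν(L_v))_v`. -/
theorem tree_OT_eq_L1 (root : V) (parent : V → V)
    (hroot : parent root = root) (hreach : ∀ v, ∃ k, parent^[k] v = root)
    (w : V → ℝ) (hw : ∀ v, 0 < w v)
    (μ ν : V → ℝ) (hμ : ∀ v, 0 ≤ μ v) (hν : ∀ v, 0 ≤ ν v)
    (hμsupp : ∀ v, μ v ≠ 0 → IsLeaf parent v) (hνsupp : ∀ v, ν v ≠ 0 → IsLeaf parent v)
    (hmass : ∑ v, μ v = ∑ v, ν v) :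
    treeOT root parent w μ ν =
      ∑ v ∈ Finset.univ.erase root,
        w v * |subMass parent μ v - subMass parent ν v| ∧
    treeOT root parent w μ ν =
      ∑ v ∈ Finset.univ.erase root,
        |w v * subMass parent μ v - w v * subMass parent ν v| := by
  have hsub : ∀ v, subMass parent μ v - subMass parent ν v =
      ∑ x, (if ∃ k, parent^[k] x = v then (1 : ℝ) else 0) * (μ x - ν x) := by
    intro v
    unfold subMass
    rw [← Finset.sum_sub_distrib]
    refine Finset.sum_congr rfl fun x _ => ?_
    split_ifs <;> ring
  have hcost : ∀ τ : V → V → ℝ, (∑ x, ∑ y, τ x y * treeDist root parent w x y) =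
      ∑ v ∈ Finset.univ.erase root, w v * ∑ x, ∑ y, τ x y *
        |(if ∃ k, parent^[k] x = v then (1 : ℝ) else 0) -
            (if ∃ k, parent^[k] y = v then (1 : ℝ) else 0)| := by
    intro τ
    simp only [treeDist, Finset.mul_sum]
    rw [Finset.sum_comm (s := Finset.univ.erase root)]
    refine Finset.sum_congr rfl fun x _ => ?_
    rw [Finset.sum_comm (s := Finset.univ.erase root)]
    refine Finset.sum_congr rfl fun y _ => Finset.sum_congr rfl fun v _ => ?_
    ring
  have main : treeOT root parent w μ ν =
      ∑ v ∈ Finset.univ.erase root,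
        w v * |subMass parent μ v - subMass parent ν v| := by
    have lower : ∀ τ, IsPlan μ ν τ → ∑ v ∈ Finset.univ.erase root,
        w v * |subMass parent μ v - subMass parent ν v| ≤
        ∑ x, ∑ y, τ x y * treeDist root parent w x y := by
      intro τ h
      rw [hcost]
      refine Finset.sum_le_sum fun v _ => mul_le_mul_of_nonneg_left ?_ (hw v).le
      rw [hsub]
      exact plan_lower (fun x => ∃ k, parent^[k] x = v) μ ν τ h
    obtain ⟨τ, hp, hτ⟩ := exists_laminar_plan (fun v x => ∃ k, parent^[k] x = v) root hreach
      (by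
        rintro u v x ⟨k, rfl⟩ ⟨l, rfl⟩
        rcases le_total k l with h | h
        · left
          rintro z ⟨m, hm⟩
          refine ⟨(l - k) + m, ?_⟩
          rw [Function.iterate_add_apply, hm, ← Function.iterate_add_apply, Nat.sub_add_cancel h]
        · right
          rintro z ⟨m, hm⟩
          refine ⟨(k - l) + m, ?_⟩
          rw [Function.iterate_add_apply, hm, ← Function.iterate_add_apply, Nat.sub_add_cancel h])
      _ μ ν hμ hν hmass le_rfl
    have upper : ∑ x, ∑ y, τ x y * treeDist root parent w x y ≤
        ∑ v ∈ Finset.univ.erase root,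
          w v * |subMass parent μ v - subMass parent ν v| := by
      rw [hcost]
      refine Finset.sum_le_sum fun v _ => mul_le_mul_of_nonneg_left ?_ (hw v).le
      rw [hsub]
      exact hτ v
    refine IsLeast.csInf_eq ⟨⟨τ, hp, le_antisymm upper (lower τ hp)⟩, ?_⟩
    rintro c ⟨σ, hσ, rfl⟩
    exact lower σ hσ
  refine ⟨main, main.trans (Finset.sum_congr rfl fun v _ => ?_)⟩
  rw [← mul_sub, abs_mul, abs_of_pos (hw v)]
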